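/- For every even positive integer n, the total number of Hermitian self-dual codes of length n over F_4 equals ∏_{i=0}^{n/2−1}(2^{2i+1}+1). -/

import Mathlib

abbrev F4 := GaloisField 2 2

/-- Hermitian inner product on `F4^n`. -/
noncomputable def hIP {n : ℕ} (x y : Fin n → F4) : F4 := ∑ i, x i * (y i) ^ 2

/-- Hamming weight. -/
noncomputable def wt {n : ℕ} (x : Fin n → F4) : ℕ := Nat.card {i : Fin n // x i ≠ 0}

/-- Hermitian dual code. -/
noncomputable def hDual {n : ℕ} (C : Submodule F4 (Fin n → F4)) : Submodule F4 (Fin n → F4) where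
  carrier := {x | ∀ c ∈ C, hIP x c = 0}
  add_mem' := by
    intro a b ha hb c hc
    have h : hIP (a + b) c = hIP a c + hIP b c := by
      simp [hIP, add_mul, Finset.sum_add_distrib]
    simp only [h, ha c hc, hb c hc, add_zero]
  zero_mem' := by intro c hc; simp [hIP]
  smul_mem' := by
    intro r x hx c hc
    have h : hIP (r • x) c = r * hIP x c := by
      simp [hIP, Finset.mul_sum, mul_assoc]
    simp only [h, hx c hc, mul_zero]

/-- Monomial transformation given by permutation `π` and nonzero scalars `s`. -/
noncomputable def monomialMap {n : ℕ} (π : Equiv.Perm (Fin n)) (s : Fin n → F4ˣ) :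
    (Fin n → F4) →ₗ[F4] (Fin n → F4) where
  toFun x := fun i => (s i : F4) * x (π i)
  map_add' := by intro x y; funext i; simp [mul_add]
  map_smul' := by intro r x; funext i; simp [mul_comm, mul_left_comm]

/-- Monomial equivalence of codes. -/
noncomputable def CodeEquiv {n : ℕ} (C C' : Submodule F4 (Fin n → F4)) : Prop :=
  ∃ (π : Equiv.Perm (Fin n)) (s : Fin n → F4ˣ), C.map (monomialMap π s) = C'

/-- Order of the automorphism group (monomial transformations preserving `C`). -/
noncomputable def autCard {n : ℕ} (C : Submodule F4 (Fin n → F4)) : ℕ :=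
  Nat.card {p : Equiv.Perm (Fin n) × (Fin n → F4ˣ) // C.map (monomialMap p.1 p.2) = C}

/-- Direct sum of two codes. -/
noncomputable def dsum {n₁ n₂ : ℕ} (C₁ : Submodule F4 (Fin n₁ → F4)) (C₂ : Submodule F4 (Fin n₂ → F4)) :
    Submodule F4 (Fin (n₁ + n₂) → F4) :=
  (C₁.comap (LinearMap.funLeft F4 F4 (Fin.castAdd n₂))) ⊓
    (C₂.comap (LinearMap.funLeft F4 F4 (Fin.natAdd n₁)))

open Classical in
/-- sign of an element: `1` at zero, `-1` elsewhere. -/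
noncomputable def sg (x : F4) : ℤ := if x = 0 then 1 else -1

/-- the nontrivial additive character obtained from the trace. -/
noncomputable def chi (x : F4) : ℤ := sg (x + x ^ 2)

noncomputable instance fintypeF4 : Fintype F4 := Fintype.ofFinite F4

theorem card_F4 : Fintype.card F4 = 4 := by
  rw [← Nat.card_eq_fintype_card, GaloisField.card 2 2 (by norm_num)]
  norm_num

theorem two_F4 : (2 : F4) = 0 := by
  have := CharP.cast_eq_zero F4 2
  exact_mod_cast this

theorem self_add (x : F4) : x + x = 0 := CharTwo.add_self_eq_zero x

theorem pow4 (x : F4) : x ^ 4 = x := by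
  have := FiniteField.pow_card x
  rwa [card_F4] at this

theorem idem_cases {x : F4} (h : x ^ 2 = x) : x = 0 ∨ x = 1 := by
  have : x * (x - 1) = 0 := by linear_combination h
  rcases mul_eq_zero.1 this with h | h
  · exact Or.inl h
  · exact Or.inr (by linear_combination h)

theorem sg_add {x y : F4} (hx : x ^ 2 = x) (hy : y ^ 2 = y) : sg (x + y) = sg x * sg y := by
  rcases idem_cases hx with rfl | rfl <;> rcases idem_cases hy with rfl | rfl <;>
    simp [sg, self_add]

theorem add_sq4 (x y : F4) : (x + y) ^ 2 = x ^ 2 + y ^ 2 := by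
  linear_combination x * y * two_F4

theorem tr_idem (x : F4) : (x + x ^ 2) ^ 2 = x + x ^ 2 := by
  rw [add_sq4]
  linear_combination pow4 x

theorem chi_add (x y : F4) : chi (x + y) = chi x * chi y := by
  unfold chi
  rw [← sg_add (tr_idem x) (tr_idem y), add_sq4]
  congr 1
  ring

theorem chi_zero : chi 0 = 1 := by simp [chi, sg]

theorem exists_tr : ∃ a : F4, a + a ^ 2 ≠ 0 := by
  by_contra! h
  have : ∀ a : F4, a = 0 ∨ a = 1 := fun a =>
    idem_cases (by linear_combination h a - a * two_F4)
  have h2 : Fintype.card F4 ≤ 2 := by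
    classical
    rw [← Finset.card_univ]
    refine (Finset.card_le_card (t := {0, 1}) ?_).trans Finset.card_le_two
    intro a _
    simpa using this a
  rw [card_F4] at h2
  omega

section
variable {n : ℕ}

theorem hIP_add_left (a b c : Fin n → F4) : hIP (a + b) c = hIP a c + hIP b c := by
  simp [hIP, add_mul, Finset.sum_add_distrib]

theorem hIP_add_right (a b c : Fin n → F4) : hIP a (b + c) = hIP a b + hIP a c := by
  simp [hIP, add_sq4, mul_add, Finset.sum_add_distrib]

theorem hIP_smul_left (r : F4) (x c : Fin n → F4) : hIP (r • x) c = r * hIP x c := by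
  simp [hIP, Finset.mul_sum, mul_assoc]

theorem hIP_smul_right (r : F4) (x c : Fin n → F4) : hIP x (r • c) = r ^ 2 * hIP x c := by
  simp only [hIP, Finset.mul_sum, Pi.smul_apply, smul_eq_mul]
  exact Finset.sum_congr rfl fun i _ => by ring

theorem hIP_symm (x y : Fin n → F4) : hIP y x = (hIP x y) ^ 2 := by
  unfold hIP
  rw [sum_pow_char 2]
  refine Finset.sum_congr rfl fun i _ => ?_
  linear_combination -(x i) ^ 2 * pow4 (y i)

theorem hIP_symm_zero {x y : Fin n → F4} (h : hIP x y = 0) : hIP y x = 0 := by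
  rw [hIP_symm, h]; simp

theorem mem_hDual {C : Submodule F4 (Fin n → F4)} {x : Fin n → F4} :
    x ∈ hDual C ↔ ∀ c ∈ C, hIP x c = 0 := Iff.rfl

theorem hDual_anti {A B : Submodule F4 (Fin n → F4)} (h : A ≤ B) : hDual B ≤ hDual A :=
  fun _ hx c hc => hx c (h hc)

theorem le_hDual_hDual (A : Submodule F4 (Fin n → F4)) : A ≤ hDual (hDual A) :=
  fun x hx _ hc => hIP_symm_zero (hc x hx)

theorem self_idem (x : Fin n → F4) : (hIP x x) ^ 2 = hIP x x := (hIP_symm x x).symm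

noncomputable def eps (x : Fin n → F4) : ℤ := sg (hIP x x)

theorem eps_add (x y : Fin n → F4) : eps (x + y) = eps x * eps y * chi (hIP x y) := by
  unfold eps chi
  rw [← sg_add (self_idem x) (self_idem y), ← sg_add _ (tr_idem _), hIP_add_left, hIP_add_right,
    hIP_add_right, hIP_symm x y]
  · congr 1; ring
  · rw [add_sq4, self_idem, self_idem]

open Classical in
/-- the set of elements of a code -/
noncomputable def els (W : Submodule F4 (Fin n → F4)) : Finset (Fin n → F4) :=
  Finset.univ.filter (· ∈ W)

theorem mem_els {W : Submodule F4 (Fin n → F4)} {x : Fin n → F4} : x ∈ els W ↔ x ∈ W := by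
  simp [els]

theorem card_els (W : Submodule F4 (Fin n → F4)) :
    (els W).card = 4 ^ Module.finrank F4 W := by
  classical
  have h := Module.natCard_eq_pow_finrank (K := F4) (V := W)
  rw [Nat.card_eq_fintype_card (α := F4), card_F4] at h
  rw [← h]
  rw [Nat.subtype_card (els W) (fun x => mem_els)]

theorem sum_shift (W : Submodule F4 (Fin n → F4)) {c : Fin n → F4} (hc : c ∈ W)
    (f : (Fin n → F4) → ℤ) : ∑ x ∈ els W, f (x + c) = ∑ x ∈ els W, f x := by
  refine Finset.sum_bij (fun x _ => x + c) ?_ ?_ ?_ ?_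
  · intro x hx
    exact mem_els.2 (W.add_mem (mem_els.1 hx) hc)
  · intro a _ b _ h
    exact add_right_cancel h
  · intro b hb
    exact ⟨b - c, mem_els.2 (W.sub_mem (mem_els.1 hb) hc), by simp⟩
  · intros; rfl

open Classical in
theorem chi_sum (W : Submodule F4 (Fin n → F4)) (v : Fin n → F4) :
    ∑ c ∈ els W, chi (hIP v c) = if v ∈ hDual W then ((els W).card : ℤ) else 0 := by
  split_ifs with h
  · rw [Finset.sum_congr rfl (g := fun _ => (1 : ℤ))]
    · simp
    · intro c hc
      rw [h c (mem_els.1 hc), chi_zero]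
  · rw [mem_hDual] at h
    push Not at h
    obtain ⟨c, hc, ht⟩ := h
    obtain ⟨a, ha⟩ := exists_tr
    have hb : hIP v (((a / hIP v c) ^ 2) • c) = a := by
      rw [hIP_smul_right, ← pow_mul]
      norm_num only
      rw [pow4, div_mul_cancel₀ _ ht]
    have hs := sum_shift W (W.smul_mem ((a / hIP v c) ^ 2) hc) (fun c => chi (hIP v c))
    simp only [hIP_add_right, chi_add, hb] at hs
    have : chi a = -1 := by simp [chi, sg, ha]
    rw [this, ← Finset.sum_mul] at hs
    linarith

theorem els_top : els (⊤ : Submodule F4 (Fin n → F4)) = Finset.univ := by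
  ext; simp [mem_els]

theorem hDual_top : hDual (⊤ : Submodule F4 (Fin n → F4)) = ⊥ := by
  classical
  rw [eq_bot_iff]
  intro x hx
  rw [Submodule.mem_bot]
  funext i
  have := hx (Pi.single i 1) trivial
  simpa [hIP, Pi.single_apply, ite_pow] using this

theorem card_mul (W : Submodule F4 (Fin n → F4)) :
    (els W).card * (els (hDual W)).card = 4 ^ n := by
  classical
  have h1 : ∑ v : Fin n → F4, ∑ c ∈ els W, chi (hIP v c) =
      ((els W).card * (els (hDual W)).card : ℤ) := by
    simp only [chi_sum]
    rw [← Finset.sum_filter]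
    simp [els, mul_comm]
  have hswap : ∀ v c : Fin n → F4, chi (hIP v c) = chi (hIP c v) := by
    intro v c
    rw [hIP_symm c v]
    unfold chi
    congr 1
    linear_combination pow4 (hIP c v)
  have h2 : ∑ v : Fin n → F4, ∑ c ∈ els W, chi (hIP v c) = (4 ^ n : ℤ) := by
    rw [Finset.sum_comm]
    simp only [hswap]
    rw [← els_top]
    simp only [chi_sum, hDual_top, Submodule.mem_bot]
    rw [Finset.sum_ite_eq' (els W) 0]
    simp [mem_els, els_top, card_F4]
  have := h1.symm.trans h2
  exact_mod_cast this

theorem finrank_hDual (W : Submodule F4 (Fin n → F4)) :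
    Module.finrank F4 W + Module.finrank F4 (hDual W) = n := by
  have := card_mul W
  rw [card_els, card_els, ← pow_add] at this
  exact Nat.pow_right_injective (le_refl 2 |>.trans (by norm_num)) this

theorem hDual_hDual (W : Submodule F4 (Fin n → F4)) : hDual (hDual W) = W := by
  refine (Submodule.eq_of_le_of_finrank_eq (le_hDual_hDual W) ?_).symm
  have h1 := finrank_hDual W
  have h2 := finrank_hDual (hDual W)
  omega

theorem hDual_sup (A B : Submodule F4 (Fin n → F4)) : hDual (A ⊔ B) = hDual A ⊓ hDual B := by
  apply le_antisymm
  · exact le_inf (hDual_anti le_sup_left) (hDual_anti le_sup_right)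
  · rintro x ⟨ha, hb⟩ c hc
    obtain ⟨a, haA, b, hbB, rfl⟩ := Submodule.mem_sup.1 hc
    rw [hIP_add_right, ha a haA, hb b hbB, add_zero]

theorem hDual_inf (A B : Submodule F4 (Fin n → F4)) : hDual (A ⊓ B) = hDual A ⊔ hDual B := by
  rw [← hDual_hDual (hDual A ⊔ hDual B), hDual_sup, hDual_hDual, hDual_hDual]

theorem exists_selfdual (hne : Even n) : ∃ C : Submodule F4 (Fin n → F4), C = hDual C := by
  classical
  have hfix : ∀ i : Fin n, Fin.rev i ≠ i := by
    intro i h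
    have := congrArg Fin.val h
    rw [Fin.val_rev] at this
    obtain ⟨k, hk⟩ := hne
    have := i.2
    omega
  let C : Submodule F4 (Fin n → F4) :=
    { carrier := {x | ∀ i, x (Fin.rev i) = x i}
      add_mem' := by
        intro a b ha hb i
        simp [ha i, hb i]
      zero_mem' := by intro i; rfl
      smul_mem' := by
        intro r x hx i
        simp [hx i] }
  refine ⟨C, le_antisymm ?_ ?_⟩
  · intro x hx c hc
    unfold hIP
    refine Finset.sum_involution (fun i _ => Fin.rev i) ?_ ?_ ?_ ?_
    · intro i _
      rw [hx i, hc i, self_add]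
    · intro i _ _
      exact hfix i
    · intro i _; exact Finset.mem_univ _
    · intro i _; exact Fin.rev_rev i
  · intro x hx i
    have h1 : (Pi.single i 1 + Pi.single (Fin.rev i) 1 : Fin n → F4) ∈ C := by
      intro j
      simp only [Pi.add_apply, Pi.single_apply, Fin.rev_eq_iff, Fin.rev_rev]
      rw [add_comm]
    have := hx _ h1
    rw [hIP_add_right] at this
    simp only [hIP, Pi.single_apply, ite_pow] at this
    simp at this
    linear_combination this - self_add (x i)

theorem exists_above (hne : Even n) {U : Submodule F4 (Fin n → F4)} (hU : U ≤ hDual U) :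
    ∃ C : Submodule F4 (Fin n → F4), C = hDual C ∧ U ≤ C := by
  obtain ⟨C, hC⟩ := exists_selfdual hne
  refine ⟨U ⊔ C ⊓ hDual U, ?_, le_sup_left⟩
  rw [hDual_sup, hDual_inf, hDual_hDual, ← hC, sup_comm C U, inf_comm (hDual U)]
  exact (sup_inf_assoc_of_le C hU).symm

theorem eps_sum {U C : Submodule F4 (Fin n → F4)} (hC : C = hDual C) (hUC : U ≤ C) :
    ∑ v ∈ els (hDual U), eps v = ((els C).card : ℤ) := by
  classical
  have hCU : C ≤ hDual U := by
    rw [hC]; exact hDual_anti hUC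
  have he : ∀ c ∈ C, eps c = 1 := by
    intro c hc
    have : hIP c c = 0 := by
      have h := hc
      rw [hC] at h
      exact h c hc
    simp [eps, sg, this]
  have h1 : ∑ c ∈ els C, ∑ v ∈ els (hDual U), eps (v + c) =
      (els C).card * ∑ v ∈ els (hDual U), eps v := by
    rw [Finset.sum_congr rfl (fun c hc => sum_shift (hDual U) (hCU (mem_els.1 hc)) eps)]
    simp
  have h2 : ∑ c ∈ els C, ∑ v ∈ els (hDual U), eps (v + c) = (els C).card * (els C).card := by
    rw [Finset.sum_comm]
    have : ∀ v ∈ els (hDual U), ∑ c ∈ els C, eps (v + c) =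
        if v ∈ C then ((els C).card : ℤ) else 0 := by
      intro v _
      have e1 : ∑ c ∈ els C, eps (v + c) = eps v * ∑ c ∈ els C, chi (hIP v c) := by
        rw [Finset.mul_sum]
        refine Finset.sum_congr rfl fun c hc => ?_
        rw [eps_add, he c (mem_els.1 hc)]; ring
      rw [e1, chi_sum, ← hC]
      split_ifs with h
      · rw [he v h, one_mul]
      · simp
    rw [Finset.sum_congr rfl this, ← Finset.sum_filter]
    have : (els (hDual U)).filter (· ∈ C) = els C := by
      ext x
      simp only [Finset.mem_filter, mem_els]
      exact ⟨fun h => h.2, fun h => ⟨hCU h, h⟩⟩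
    rw [this]
    simp
  have hpos : ((els C).card : ℤ) ≠ 0 := by
    rw [card_els]; positivity
  exact mul_left_cancel₀ hpos (h1.symm.trans h2)

open Classical in
/-- vectors which extend the isotropic code `U` -/
noncomputable def iso (U : Submodule F4 (Fin n → F4)) : Finset (Fin n → F4) :=
  (els (hDual U)).filter (fun v => hIP v v = 0 ∧ v ∉ U)

theorem card_iso {U C : Submodule F4 (Fin n → F4)} (hC : C = hDual C) (hUC : U ≤ C) :
    2 * ((iso U).card + (els U).card) = (els (hDual U)).card + (els C).card := by
  classical
  have hCU : C ≤ hDual U := by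
    rw [hC]; exact hDual_anti hUC
  have h0 : (iso U).card + (els U).card =
      ((els (hDual U)).filter (fun v => hIP v v = 0)).card := by
    rw [← Finset.card_filter_add_card_filter_not (s := (els (hDual U)).filter (fun v => hIP v v = 0))
      (fun v => v ∉ U)]
    congr 2
    · ext x; simp [iso, Finset.mem_filter, and_assoc]
    · ext x
      simp only [Finset.mem_filter, mem_els, not_not]
      constructor
      · intro h
        have h' := hUC h
        have h'' := h'
        rw [hC] at h''
        exact ⟨⟨hCU h', h'' x h'⟩, h⟩
      · exact fun h => h.2
  have hs := eps_sum hC hUC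
  have h3 : ∀ v : Fin n → F4, eps v = 2 * (if hIP v v = 0 then 1 else 0) - 1 := by
    intro v
    unfold eps sg
    split_ifs <;> norm_num
  simp only [h3, Finset.sum_sub_distrib, ← Finset.mul_sum, Finset.sum_boole] at hs
  rw [h0]
  simp at hs
  zify
  linarith

theorem finrank_selfdual {C : Submodule F4 (Fin n → F4)} (hC : C = hDual C) :
    2 * Module.finrank F4 C = n := by
  have := finrank_hDual C
  rw [← hC] at this
  omega

open Classical in
/-- self-dual codes containing `U` -/
noncomputable def above (U : Submodule F4 (Fin n → F4)) : Finset (Submodule F4 (Fin n → F4)) :=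
  letI : Fintype (Submodule F4 (Fin n → F4)) := Fintype.ofFinite _
  Finset.univ.filter (fun C => C = hDual C ∧ U ≤ C)

theorem mem_above {U C : Submodule F4 (Fin n → F4)} : C ∈ above U ↔ C = hDual C ∧ U ≤ C := by
  simp [above]

theorem ext_iso {U : Submodule F4 (Fin n → F4)} (hU : U ≤ hDual U) {v : Fin n → F4}
    (hv : v ∈ hDual U) (hvv : hIP v v = 0) :
    U ⊔ Submodule.span F4 {v} ≤ hDual (U ⊔ Submodule.span F4 {v}) := by
  have key : ∀ x ∈ U ⊔ Submodule.span F4 {v}, hIP x v = 0 := by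
    intro x hx
    obtain ⟨a, ha, b, hb, rfl⟩ := Submodule.mem_sup.1 hx
    obtain ⟨r, rfl⟩ := Submodule.mem_span_singleton.1 hb
    rw [hIP_add_left, hIP_smul_left, hvv, hIP_symm_zero (hv a ha)]; simp
  rw [hDual_sup]
  refine le_inf (sup_le hU ?_) ?_
  · rw [Submodule.span_singleton_le_iff_mem]; exact hv
  · intro x hx c hc
    obtain ⟨r, rfl⟩ := Submodule.mem_span_singleton.1 hc
    rw [hIP_smul_right, key x hx, mul_zero]

theorem finrank_ext {U : Submodule F4 (Fin n → F4)} {v : Fin n → F4} (hv : v ∉ U) :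
    Module.finrank F4 (U ⊔ Submodule.span F4 {v} : Submodule F4 (Fin n → F4)) =
      Module.finrank F4 U + 1 := by
  have h := Submodule.finrank_sup_add_finrank_inf_eq U (Submodule.span F4 {v})
  have h0 : v ≠ 0 := by rintro rfl; exact hv U.zero_mem
  have hd : U ⊓ Submodule.span F4 {v} = ⊥ := by
    rw [← disjoint_iff]
    exact (Submodule.disjoint_span_singleton' h0).2 hv
  rw [hd, finrank_bot, finrank_span_singleton h0] at h
  omega

theorem double_count {U : Submodule F4 (Fin n → F4)} {N a : ℕ}
    (hN : ∀ v ∈ iso U, (above (U ⊔ Submodule.span F4 {v})).card = N)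
    (ha : ∀ C ∈ above U, (els C).card = a + (els U).card) :
    (above U).card * a = (iso U).card * N := by
  classical
  have h := Finset.sum_card_bipartiteAbove_eq_sum_card_bipartiteBelow
    (s := above U) (t := iso U) (fun C v => v ∈ C)
  rw [Finset.sum_congr rfl (g := fun _ => a), Finset.sum_congr rfl (s₁ := iso U) (g := fun _ => N)]
    at h
  · simpa using h
  · intro v hv
    rw [← hN v hv]
    congr 1
    ext C
    simp only [Finset.bipartiteBelow, Finset.mem_filter, mem_above, sup_le_iff,
      Submodule.span_singleton_le_iff_mem, and_assoc]
  · intro C hC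
    have hC' := mem_above.1 hC
    have hs : els U ⊆ els C := fun x hx => mem_els.2 (hC'.2 (mem_els.1 hx))
    have : (Finset.bipartiteAbove (fun C v => v ∈ C) (iso U) C) = els C \ els U := by
      ext x
      simp only [Finset.bipartiteAbove, iso, Finset.mem_filter, mem_els, Finset.mem_sdiff]
      constructor
      · rintro ⟨⟨_, _, h⟩, h'⟩; exact ⟨h', h⟩
      · rintro ⟨h', h⟩
        have h2 := h'
        rw [hC'.1] at h2
        exact ⟨⟨hDual_anti hC'.2 h2, h2 x h', h⟩, h'⟩
    rw [this, Finset.card_sdiff_of_subset hs, ha C hC]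
    omega

theorem main_count (hne : Even n) (j : ℕ) : ∀ U : Submodule F4 (Fin n → F4), U ≤ hDual U →
    2 * (Module.finrank F4 U + j) = n →
    (above U).card = ∏ i ∈ Finset.range j, (2 ^ (2 * i + 1) + 1) := by
  induction j with
  | zero =>
    intro U hU hn
    have hd := finrank_hDual U
    have hUd : U = hDual U := Submodule.eq_of_le_of_finrank_eq hU (by omega)
    rw [Finset.range_zero, Finset.prod_empty, Finset.card_eq_one]
    refine ⟨U, ?_⟩
    ext C
    rw [mem_above, Finset.mem_singleton]
    constructor
    · rintro ⟨hC, hUC⟩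
      have := finrank_selfdual hC
      exact (Submodule.eq_of_le_of_finrank_eq hUC (by omega)).symm
    · rintro rfl
      exact ⟨hUd, le_rfl⟩
  | succ j ih =>
    intro U hU hn
    obtain ⟨C, hC, hUC⟩ := exists_above hne hU
    have hci := card_iso hC hUC
    have hd := finrank_hDual U
    set k := Module.finrank F4 U with hk
    have hcd : Module.finrank F4 (hDual U) = k + 2 * (j + 1) := by omega
    have hcard : ∀ C : Submodule F4 (Fin n → F4), C = hDual C →
        (els C).card = 4 ^ (k + (j + 1)) := by
      intro C hC
      have := finrank_selfdual hC
      rw [card_els]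
      congr 1
      omega
    obtain ⟨b, hb⟩ : ∃ b, 4 ^ (j + 1) = b + 1 :=
      ⟨4 ^ (j + 1) - 1, (Nat.sub_add_cancel (Nat.one_le_pow _ _ (by norm_num))).symm⟩
    have hbpos : 0 < b := by
      have : 4 ^ 1 ≤ 4 ^ (j + 1) := Nat.pow_le_pow_right (by norm_num) (by omega)
      omega
    have hD := double_count (U := U) (a := 4 ^ k * b)
      (N := ∏ i ∈ Finset.range j, (2 ^ (2 * i + 1) + 1)) ?_ ?_
    · rw [hcard C hC, card_els, card_els, hcd, ← hk] at hci
      have h2 : 4 ^ (j + 1) = 2 * 2 ^ (2 * j + 1) := by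
        rw [← pow_succ', show 2 * j + 1 + 1 = 2 * (j + 1) by ring, pow_mul]
        norm_num
      have hiso : (iso U).card = 4 ^ k * b * (2 ^ (2 * j + 1) + 1) := by
        rw [pow_add, pow_add, pow_mul', hb] at hci
        rw [hb] at h2
        generalize 2 ^ (2 * j + 1) = t at *
        generalize 4 ^ k = q at *
        have h2' : b = 2 * t - 1 := by omega
        zify at *
        have : (b : ℤ) = 2 * t - 1 := by linarith
        subst_vars
        rw [this] at hci ⊢
        linarith
      rw [hiso] at hD
      rw [Finset.prod_range_succ]
      have hpos : 0 < 4 ^ k * b := by positivity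
      apply Nat.eq_of_mul_eq_mul_right hpos
      rw [hD]; ring
    · intro v hv
      simp only [iso, Finset.mem_filter, mem_els] at hv
      refine ih _ (ext_iso hU hv.1 hv.2.1) ?_
      rw [finrank_ext hv.2.2]
      omega
    · intro C hC
      rw [hcard C (mem_above.1 hC).1, card_els, pow_add, hb]
      ring

end

/-- The total number of Hermitian self-dual codes of even length `n` over `F₄`
is `∏_{i=0}^{n/2-1} (2^{2i+1}+1)`. -/
theorem stmt7 {n : ℕ} (hn : 0 < n) (hne : Even n) :
    Nat.card {C : Submodule F4 (Fin n → F4) // C = hDual C} =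
      ∏ i ∈ Finset.range (n / 2), (2 ^ (2 * i + 1) + 1) := by
  rw [← main_count hne (n / 2) ⊥ bot_le ?_]
  · exact Nat.subtype_card (above ⊥) (fun C => by simp [mem_above])
  · rw [finrank_bot, zero_add]
    exact Nat.mul_div_cancel' hne.two_dvd
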